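/- Let A = C(α₀, α₁, …, α_{n−1}) be an n×n circulant matrix with real entries α_i ∈ ℝ. Then ‖A‖_{2,2} = max{ |Σ_{i=0}^{n−1} α_i ω^i| : ω ∈ ℂ, ω^n = 1 }, and for every p ∈ [1,∞], ‖A‖_{2,2} ≤ ‖A‖_{p,p} ≤ (Σ_{i=0}^{n−1} |α_i|)^{(2−p)/p} · ‖A‖_{2,2}^{2(p−1)/p} if p ∈ [1,2), and ‖A‖_{2,2} ≤ ‖A‖_{p,p} ≤ (Σ_{i=0}^{n−1} |α_i|)^{(p−2)/p} · ‖A‖_{2,2}^{2/p} if p ∈ [2,∞]. -/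

import Mathlib

open scoped BigOperators ENNReal
open Matrix

/-- The `ℓ^p` norm of a finitely-indexed vector (with the convention `1/∞ = 0`). -/
noncomputable def lpNorm {ι : Type*} [Fintype ι] {E : Type*} [Norm E] (p : ℝ≥0∞)
    (x : ι → E) : ℝ :=
  if p = ∞ then ⨆ i, ‖x i‖ else (∑ i, ‖x i‖ ^ p.toReal) ^ p.toReal⁻¹

/-- The operator norm of a square complex matrix acting on `ℓ^p`. -/
noncomputable def opNorm {ι : Type*} [Fintype ι] (p : ℝ≥0∞) (A : Matrix ι ι ℂ) : ℝ :=
  sSup {r : ℝ | ∃ x : ι → ℂ, lpNorm p x = 1 ∧ r = lpNorm p (A.mulVec x)}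

/-- A unitary permutation matrix: a permutation matrix whose nonzero entries are
unimodular complex numbers. -/
def IsUnitaryPermutation {n : ℕ} (S : Matrix (Fin n) (Fin n) ℂ) : Prop :=
  ∃ (σ : Equiv.Perm (Fin n)) (α : Fin n → ℂ), (∀ i, ‖α i‖ = 1) ∧
    ∀ i j, S i j = if j = σ i then α i else 0

/-- `A` is logarithmic affine: `‖A‖_{p,p} = ‖A‖_{1,1}^{1/p} ‖A‖_{∞,∞}^{1-1/p}` for all
`p ∈ [1,∞]` (with `1/∞ = 0`). -/
def LogAffine {ι : Type*} [Fintype ι] (A : Matrix ι ι ℂ) : Prop :=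
  ∀ p : ℝ≥0∞, 1 ≤ p →
    opNorm p A = opNorm 1 A ^ p.toReal⁻¹ * opNorm ⊤ A ^ (1 - p.toReal⁻¹)

/-- The circulant matrix `C(α₀,…,α_{n-1})`, whose `(i,j)` entry is `α_{j-i mod n}`. -/
noncomputable def circulantC {n : ℕ} (α : Fin n → ℂ) : Matrix (Fin n) (Fin n) ℂ :=
  Matrix.of fun i j => α (j - i)

/-- The Hankel-type matrix `H(α₀,…,α_{n-1})`, whose `(i,j)` entry is `α_{i+j mod n}`. -/
noncomputable def hankelH {n : ℕ} (α : Fin n → ℂ) : Matrix (Fin n) (Fin n) ℂ :=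
  Matrix.of fun i j => α (i + j)

section OpNorm

variable {ι : Type*} [Fintype ι]

theorem lpNorm_eq_norm_toLp (p : ℝ≥0∞) [hp : Fact (1 ≤ p)] (x : ι → ℂ) :
    lpNorm p x = ‖WithLp.toLp p x‖ := by
  unfold lpNorm
  split_ifs with h
  · subst h
    rw [PiLp.norm_eq_ciSup]
  · have : 0 < p.toReal := ENNReal.toReal_pos (zero_lt_one.trans_le hp.out).ne' h
    rw [PiLp.norm_eq_sum this, one_div]

theorem lpNorm_mulVec_le_opNorm_mul (p : ℝ≥0∞) [hp : Fact (1 ≤ p)] (A : Matrix ι ι ℂ)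
    (x : ι → ℂ) : lpNorm p (A *ᵥ x) ≤ opNorm p A * lpNorm p x := by
  classical
  let T : PiLp p (fun _ : ι => ℂ) →L[ℂ] PiLp p (fun _ : ι => ℂ) :=
    LinearMap.toContinuousLinearMap (A.toLpLin p p)
  have hT (y : ι → ℂ) : lpNorm p (A *ᵥ y) = ‖T (WithLp.toLp p y)‖ := by
    rw [lpNorm_eq_norm_toLp]
    rfl
  rcases eq_or_ne x 0 with rfl | hx
  · simp [lpNorm_eq_norm_toLp]
  have hx0 : 0 < lpNorm p x := by
    rw [lpNorm_eq_norm_toLp, norm_pos_iff]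
    simpa using hx
  rw [← div_le_iff₀ hx0]
  refine le_csSup ⟨‖T‖, ?_⟩ ⟨((lpNorm p x)⁻¹ : ℂ) • x, ?_, ?_⟩
  · rintro _ ⟨y, hy, rfl⟩
    rw [hT]
    rw [lpNorm_eq_norm_toLp] at hy
    simpa [hy] using T.le_opNorm (WithLp.toLp p y)
  · rw [lpNorm_eq_norm_toLp, WithLp.toLp_smul, norm_smul, ← lpNorm_eq_norm_toLp]
    simp [abs_of_pos hx0, hx0.ne']
  · rw [mulVec_smul, lpNorm_eq_norm_toLp p (_ • _), WithLp.toLp_smul, norm_smul,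
      ← lpNorm_eq_norm_toLp]
    simp [abs_of_pos hx0, div_eq_inv_mul]

theorem opNorm_nonneg (p : ℝ≥0∞) [Fact (1 ≤ p)] (A : Matrix ι ι ℂ) : 0 ≤ opNorm p A := by
  refine Real.sSup_nonneg ?_
  rintro _ ⟨x, -, rfl⟩
  rw [lpNorm_eq_norm_toLp]
  exact norm_nonneg _

theorem opNorm_le_of_forall {p : ℝ≥0∞} {A : Matrix ι ι ℂ} {K : ℝ} (hK : 0 ≤ K)
    (h : ∀ x, lpNorm p x = 1 → lpNorm p (A *ᵥ x) ≤ K) : opNorm p A ≤ K := by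
  refine Real.sSup_le ?_ hK
  rintro _ ⟨x, hx, rfl⟩
  exact h x hx

theorem norm_le_opNorm_of_mulVec_eq_smul (p : ℝ≥0∞) [Fact (1 ≤ p)] {A : Matrix ι ι ℂ} {μ : ℂ}
    {x : ι → ℂ} (hx : x ≠ 0) (h : A *ᵥ x = μ • x) : ‖μ‖ ≤ opNorm p A := by
  have key := lpNorm_mulVec_le_opNorm_mul p A x
  have hx0 : 0 < ‖WithLp.toLp p x‖ := by
    rw [norm_pos_iff]
    simpa using hx
  rw [h, lpNorm_eq_norm_toLp, lpNorm_eq_norm_toLp, WithLp.toLp_smul, norm_smul] at key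
  exact le_of_mul_le_mul_right key hx0

open scoped Matrix.Norms.L2Operator in
theorem opNorm_two_le_l2_opNorm [DecidableEq ι] (A : Matrix ι ι ℂ) : opNorm 2 A ≤ ‖A‖ := by
  refine opNorm_le_of_forall (norm_nonneg _) fun x hx => ?_
  rw [lpNorm_eq_norm_toLp] at hx ⊢
  simpa [hx] using A.l2_opNorm_mulVec (WithLp.toLp 2 x)

open scoped Matrix.Norms.L2Operator in
theorem exists_mem_spectrum_opNorm_two_le [DecidableEq ι] [Nonempty ι] (A : Matrix ι ι ℂ)
    (hA : IsStarNormal A) : ∃ μ ∈ spectrum ℂ A, opNorm 2 A ≤ ‖μ‖ := by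
  obtain ⟨μ, hμ, h⟩ := spectrum.exists_nnnorm_eq_spectralRadius A
  rw [IsStarNormal.spectralRadius_eq_nnnorm A, ENNReal.coe_inj] at h
  exact ⟨μ, hμ, (opNorm_two_le_l2_opNorm A).trans_eq (congrArg NNReal.toReal h).symm⟩

end OpNorm

section Circulant

variable {n : ℕ} [NeZero n]

theorem circulantC_single_mul (a b : Fin n) :
    circulantC (Pi.single a 1) * circulantC (Pi.single b 1) = circulantC (Pi.single (a + b) 1) := by
  ext i j
  rw [mul_apply, Finset.sum_eq_single (i + a)]
  · simp only [circulantC, of_apply, Pi.single_apply]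
    have : j - i = a + b ↔ j - (i + a) = b := by
      constructor <;> intro h
      · rw [← sub_sub, h, add_sub_cancel_left]
      · rw [← h]; abel
    simp [this]
  · intro k _ hk
    have : k - i ≠ a := fun h => hk (by rw [← h]; abel)
    simp [circulantC, Pi.single_apply, this]
  · simp

theorem circulantC_single_zero : circulantC (Pi.single (0 : Fin n) 1) = 1 := by
  ext i j
  simp [circulantC, Pi.single_apply, one_apply, sub_eq_zero, eq_comm]

theorem circulantC_single_one_pow (k : ℕ) :
    circulantC (Pi.single (1 : Fin n) 1) ^ k = circulantC (Pi.single (Fin.ofNat n k) 1) := by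
  induction k with
  | zero => simpa using circulantC_single_zero.symm
  | succ k ih =>
    rw [pow_succ, ih, circulantC_single_mul]
    congr 2
    ext
    simp [Fin.val_add]

theorem circulantC_eq_aeval (α : Fin n → ℂ) :
    circulantC α = Polynomial.aeval (circulantC (Pi.single (1 : Fin n) 1))
      (∑ i : Fin n, Polynomial.monomial (i : ℕ) (α i)) := by
  simp only [map_sum, Polynomial.aeval_monomial, circulantC_single_one_pow, ← Algebra.smul_def]
  ext i j
  simp [Matrix.sum_apply, circulantC, Pi.single_apply]

theorem exists_root_of_mem_spectrum_circulantC (α : Fin n → ℂ) {μ : ℂ}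
    (hμ : μ ∈ spectrum ℂ (circulantC α)) : ∃ ω : ℂ, ω ^ n = 1 ∧ μ = ∑ i, α i * ω ^ (i : ℕ) := by
  rw [circulantC_eq_aeval, spectrum.map_polynomial_aeval_of_nonempty _ _
    (spectrum.nonempty_of_isAlgClosed_of_finiteDimensional ℂ _)] at hμ
  obtain ⟨ω, hω, rfl⟩ := hμ
  refine ⟨ω, ?_, by simp [Polynomial.eval_finsetSum]⟩
  have h := spectrum.pow_mem_pow _ n hω
  rw [circulantC_single_one_pow] at h
  simpa [circulantC_single_zero] using h

theorem circulantC_eq_circulant (α : Fin n → ℂ) : circulantC α = circulant fun i => α (-i) := by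
  ext i j
  simp [circulantC]

theorem isStarNormal_circulantC (α : Fin n → ℂ) : IsStarNormal (circulantC α) := by
  refine ⟨?_⟩
  rw [star_eq_conjTranspose, circulantC_eq_circulant, conjTranspose_circulant]
  exact circulant_mul_comm _ _

theorem circulantC_mulVec_pow (α : Fin n → ℂ) {ω : ℂ} (hω : ω ^ n = 1) :
    circulantC α *ᵥ (fun i => ω ^ (i : ℕ)) =
      (∑ i, α i * ω ^ (i : ℕ)) • fun i : Fin n => ω ^ (i : ℕ) := by
  ext i
  simp only [mulVec, dotProduct, circulantC, of_apply, Pi.smul_apply, smul_eq_mul]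
  rw [← Equiv.sum_comp (Equiv.addRight i), Finset.sum_mul]
  refine Finset.sum_congr rfl fun k _ => ?_
  simp only [Equiv.coe_addRight, add_sub_cancel_right, Fin.val_add]
  rw [← pow_eq_pow_mod _ hω, pow_add, mul_assoc]

theorem norm_sum_le_opNorm_circulantC (p : ℝ≥0∞) [Fact (1 ≤ p)] (α : Fin n → ℂ) {ω : ℂ}
    (hω : ω ^ n = 1) : ‖∑ i, α i * ω ^ (i : ℕ)‖ ≤ opNorm p (circulantC α) :=
  norm_le_opNorm_of_mulVec_eq_smul p
    (fun h => by simpa using congrFun h (0 : Fin n)) (circulantC_mulVec_pow α hω)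

theorem isGreatest_opNorm_two_circulantC (α : Fin n → ℂ) :
    IsGreatest {r : ℝ | ∃ ω : ℂ, ω ^ n = 1 ∧ r = ‖∑ i, α i * ω ^ (i : ℕ)‖}
      (opNorm 2 (circulantC α)) := by
  constructor
  · obtain ⟨μ, hμ, hle⟩ := exists_mem_spectrum_opNorm_two_le _ (isStarNormal_circulantC α)
    obtain ⟨ω, hω, rfl⟩ := exists_root_of_mem_spectrum_circulantC α hμ
    exact ⟨ω, hω, hle.antisymm (norm_sum_le_opNorm_circulantC 2 α hω)⟩
  · rintro _ ⟨ω, hω, rfl⟩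
    exact norm_sum_le_opNorm_circulantC 2 α hω

theorem opNorm_two_le_opNorm_circulantC (p : ℝ≥0∞) [Fact (1 ≤ p)] (α : Fin n → ℂ) :
    opNorm 2 (circulantC α) ≤ opNorm p (circulantC α) := by
  obtain ⟨ω, hω, h⟩ := (isGreatest_opNorm_two_circulantC α).1
  exact h.trans_le (norm_sum_le_opNorm_circulantC p α hω)

theorem sum_norm_circulantC_row (α : Fin n → ℂ) (i : Fin n) :
    ∑ j, ‖circulantC α i j‖ = ∑ k, ‖α k‖ :=
  Equiv.sum_comp (Equiv.subRight i) fun k => ‖α k‖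

theorem sum_norm_circulantC_col (α : Fin n → ℂ) (j : Fin n) :
    ∑ i, ‖circulantC α i j‖ = ∑ k, ‖α k‖ :=
  Equiv.sum_comp (Equiv.subLeft j) fun k => ‖α k‖

end Circulant

section RieszThorin

open Complex

variable {ι : Type*} [Fintype ι]

/-- The number `(w / ‖w‖) * ‖w‖ ^ z`, with value `0` at `w = 0`; it is an entire function of the
exponent `z`. -/
noncomputable def phasePow (w z : ℂ) : ℂ :=
  w / ‖w‖ * exp (z * Real.log ‖w‖)

@[simp]
theorem zero_phasePow (z : ℂ) : phasePow 0 z = 0 := by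
  simp [phasePow]

theorem norm_phasePow {w : ℂ} (hw : w ≠ 0) (z : ℂ) : ‖phasePow w z‖ = ‖w‖ ^ z.re := by
  have h : 0 < ‖w‖ := norm_pos_iff.2 hw
  rw [phasePow, norm_mul, norm_div, norm_real, norm_norm, div_self h.ne', one_mul, norm_exp,
    re_mul_ofReal, Real.rpow_def_of_pos h, mul_comm]

theorem norm_phasePow_le_rpow (w z : ℂ) : ‖phasePow w z‖ ≤ ‖w‖ ^ z.re := by
  rcases eq_or_ne w 0 with rfl | hw
  · simpa using Real.rpow_nonneg le_rfl _
  · exact (norm_phasePow hw z).le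

theorem norm_phasePow_le_one {w z : ℂ} (hw : ‖w‖ ≤ 1) (hz : 0 ≤ z.re) : ‖phasePow w z‖ ≤ 1 :=
  (norm_phasePow_le_rpow w z).trans (Real.rpow_le_one (norm_nonneg _) hw hz)

theorem differentiable_phasePow (w : ℂ) : Differentiable ℂ (phasePow w) := by
  unfold phasePow
  fun_prop

theorem phasePow_ofReal (w : ℂ) (r : ℝ) : phasePow w r = w / ‖w‖ * (‖w‖ ^ r : ℝ) := by
  rcases eq_or_ne w 0 with rfl | hw
  · simp
  rw [phasePow, Real.rpow_def_of_pos (norm_pos_iff.2 hw), mul_comm (r : ℂ)]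
  push_cast
  rfl

theorem phasePow_phasePow (w z : ℂ) (r : ℝ) : phasePow (phasePow w r) z = phasePow w (r * z) := by
  rcases eq_or_ne w 0 with rfl | hw
  · simp
  have h : 0 < ‖w‖ := norm_pos_iff.2 hw
  have hn : ‖phasePow w r‖ = ‖w‖ ^ r := by simp [norm_phasePow hw]
  have h0 : ((‖w‖ ^ r : ℝ) : ℂ) ≠ 0 := ofReal_ne_zero.2 (Real.rpow_pos_of_pos h r).ne'
  rw [phasePow, hn, Real.log_rpow h, phasePow_ofReal, mul_div_cancel_right₀ _ h0, phasePow]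
  push_cast
  ring_nf

theorem phasePow_div_ofReal (w : ℂ) {c : ℝ} (hc : 0 < c) (r : ℝ) :
    phasePow (w / c) r = phasePow w r / (c ^ r : ℝ) := by
  have hc' : (c : ℂ) ≠ 0 := ofReal_ne_zero.2 hc.ne'
  rw [phasePow_ofReal, phasePow_ofReal, norm_div, norm_real, Real.norm_of_nonneg hc.le,
    Real.div_rpow (norm_nonneg w) hc.le]
  push_cast
  rw [div_div_div_cancel_right₀ hc', mul_div_assoc]

theorem phasePow_star_mul_self {w : ℂ} (hw : w ≠ 0) (r : ℝ) :
    phasePow (star w) r * w = (‖w‖ ^ (r + 1) : ℝ) := by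
  have h : (‖w‖ : ℂ) ≠ 0 := ofReal_ne_zero.2 (norm_ne_zero_iff.2 hw)
  have hsq : star w * w = (‖w‖ : ℂ) ^ 2 := conj_mul' w
  rw [phasePow_ofReal, norm_star, Real.rpow_add_one (norm_ne_zero_iff.2 hw), mul_right_comm,
    div_mul_eq_mul_div, hsq, ofReal_mul]
  field_simp

theorem phasePow_one (w : ℂ) : phasePow w 1 = w := by
  rcases eq_or_ne w 0 with rfl | hw
  · simp
  have h : 0 < ‖w‖ := norm_pos_iff.2 hw
  rw [phasePow, one_mul, ← ofReal_exp, Real.exp_log h,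
    div_mul_cancel₀ _ (ofReal_ne_zero.2 h.ne')]

/-- The analytic family of bilinear forms used to interpolate the norms of `A` in the
Riesz–Thorin theorem. -/
noncomputable def interpForm (A : Matrix ι ι ℂ) (a b : ι → ℂ) (z : ℂ) : ℂ :=
  ∑ i, ∑ j, phasePow (b i) (1 - z) * A i j * phasePow (a j) z

variable {A : Matrix ι ι ℂ} {a b : ι → ℂ}

theorem interpForm_eq_dotProduct (A : Matrix ι ι ℂ) (a b : ι → ℂ) (z : ℂ) :
    interpForm A a b z = (fun i => phasePow (b i) (1 - z)) ⬝ᵥ A *ᵥ fun j => phasePow (a j) z := by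
  simp [interpForm, dotProduct, mulVec, Finset.mul_sum, mul_assoc]

theorem norm_interpForm_le_sum (A : Matrix ι ι ℂ) (a b : ι → ℂ) (z : ℂ) :
    ‖interpForm A a b z‖ ≤ ∑ i, ∑ j, ‖phasePow (b i) (1 - z)‖ * ‖A i j‖ * ‖phasePow (a j) z‖ := by
  refine (norm_sum_le _ _).trans (Finset.sum_le_sum fun i _ => (norm_sum_le _ _).trans_eq ?_)
  simp only [norm_mul]

theorem differentiable_interpForm (A : Matrix ι ι ℂ) (a b : ι → ℂ) :
    Differentiable ℂ (interpForm A a b) := by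
  unfold interpForm
  have h (w : ℂ) : Differentiable ℂ fun z => phasePow w (1 - z) :=
    (differentiable_phasePow w).comp (by fun_prop)
  have h' := differentiable_phasePow
  fun_prop

theorem norm_apply_le_one_of_sum_le_one (ha : ∑ j, ‖a j‖ ≤ 1) (j : ι) : ‖a j‖ ≤ 1 :=
  (Finset.single_le_sum (fun i _ => norm_nonneg (a i)) (Finset.mem_univ j)).trans ha

theorem bddAbove_norm_interpForm (A : Matrix ι ι ℂ) (ha : ∑ j, ‖a j‖ ≤ 1) (hb : ∑ j, ‖b j‖ ≤ 1)
    {l u : ℝ} (hl : 0 ≤ l) (hu : u ≤ 1) :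
    BddAbove ((norm ∘ interpForm A a b) '' HadamardThreeLines.verticalClosedStrip l u) := by
  refine ⟨∑ i, ∑ j, 1 * ‖A i j‖ * 1, ?_⟩
  rintro _ ⟨z, hz, rfl⟩
  obtain ⟨hlz, hzu⟩ := hz
  refine (norm_interpForm_le_sum A a b z).trans ?_
  gcongr with i _ j _
  · exact norm_phasePow_le_one (norm_apply_le_one_of_sum_le_one hb i)
      (by simpa using hzu.trans hu)
  · exact norm_phasePow_le_one (norm_apply_le_one_of_sum_le_one ha j) (hl.trans hlz)

theorem norm_interpForm_le_of_re_eq_zero {S : ℝ} (hS : 0 ≤ S) (hA : ∀ i, ∑ j, ‖A i j‖ ≤ S)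
    (ha : ∑ j, ‖a j‖ ≤ 1) (hb : ∑ j, ‖b j‖ ≤ 1) {z : ℂ} (hz : z.re = 0) :
    ‖interpForm A a b z‖ ≤ S := by
  calc ‖interpForm A a b z‖
      ≤ ∑ i, ∑ j, ‖phasePow (b i) (1 - z)‖ * ‖A i j‖ * ‖phasePow (a j) z‖ :=
        norm_interpForm_le_sum A a b z
    _ ≤ ∑ i, ∑ j, ‖b i‖ * ‖A i j‖ * 1 := by
        gcongr with i _ j _
        · simpa [hz] using norm_phasePow_le_rpow (b i) (1 - z)
        · exact norm_phasePow_le_one (norm_apply_le_one_of_sum_le_one ha j) hz.ge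
    _ = ∑ i, ‖b i‖ * ∑ j, ‖A i j‖ := by simp [Finset.mul_sum]
    _ ≤ ∑ i, ‖b i‖ * S := by gcongr with i; exact hA i
    _ ≤ S := by
        rw [← Finset.sum_mul]
        exact mul_le_of_le_one_left hS hb

theorem norm_interpForm_le_of_re_eq_one {S : ℝ} (hS : 0 ≤ S) (hA : ∀ j, ∑ i, ‖A i j‖ ≤ S)
    (ha : ∑ j, ‖a j‖ ≤ 1) (hb : ∑ j, ‖b j‖ ≤ 1) {z : ℂ} (hz : z.re = 1) :
    ‖interpForm A a b z‖ ≤ S := by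
  have h : interpForm A a b z = interpForm Aᵀ b a (1 - z) := by
    simp only [interpForm, sub_sub_cancel, transpose_apply]
    rw [Finset.sum_comm]
    refine Finset.sum_congr rfl fun i _ => Finset.sum_congr rfl fun j _ => ?_
    ring
  rw [h]
  exact norm_interpForm_le_of_re_eq_zero hS hA hb ha (by simp [hz])

theorem lpNorm_two_phasePow_le_one (ha : ∑ j, ‖a j‖ ≤ 1) {z : ℂ} (hz : z.re = 1 / 2) :
    lpNorm 2 (fun j => phasePow (a j) z) ≤ 1 := by
  rw [lpNorm, if_neg ENNReal.ofNat_ne_top]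
  refine Real.rpow_le_one (by positivity) (le_trans (Finset.sum_le_sum fun j _ => ?_) ha)
    (by positivity)
  calc ‖phasePow (a j) z‖ ^ (2 : ℝ≥0∞).toReal ≤ (‖a j‖ ^ z.re) ^ (2 : ℝ≥0∞).toReal := by
        gcongr
        exact norm_phasePow_le_rpow _ _
    _ = ‖a j‖ := by
        rw [← Real.rpow_mul (norm_nonneg _), hz]
        simp

theorem norm_dotProduct_le_lpNorm_two (x y : ι → ℂ) : ‖x ⬝ᵥ y‖ ≤ lpNorm 2 x * lpNorm 2 y := by
  have h := norm_inner_le_norm (𝕜 := ℂ) (WithLp.toLp 2 (star x)) (WithLp.toLp 2 y)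
  rw [EuclideanSpace.inner_toLp_toLp, star_star, dotProduct_comm, ← lpNorm_eq_norm_toLp,
    ← lpNorm_eq_norm_toLp] at h
  simpa [lpNorm] using h

theorem norm_interpForm_le_of_re_eq_half (A : Matrix ι ι ℂ) (ha : ∑ j, ‖a j‖ ≤ 1)
    (hb : ∑ j, ‖b j‖ ≤ 1) {z : ℂ} (hz : z.re = 1 / 2) :
    ‖interpForm A a b z‖ ≤ opNorm 2 A := by
  rw [interpForm_eq_dotProduct]
  have hN := opNorm_nonneg 2 A
  have h0 (x : ι → ℂ) : 0 ≤ lpNorm 2 x := by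
    rw [lpNorm_eq_norm_toLp]
    exact norm_nonneg _
  calc _ ≤ _ := norm_dotProduct_le_lpNorm_two _ _
    _ ≤ 1 * (opNorm 2 A * 1) := by
        refine mul_le_mul (lpNorm_two_phasePow_le_one hb ?_)
          ((lpNorm_mulVec_le_opNorm_mul 2 A _).trans ?_) (h0 _) zero_le_one
        · rw [sub_re, hz]
          norm_num
        · gcongr
          exact lpNorm_two_phasePow_le_one ha hz
    _ = opNorm 2 A := by ring

theorem norm_interpForm_le_of_le_half {S : ℝ} (hS : 0 ≤ S) (hA : ∀ i, ∑ j, ‖A i j‖ ≤ S)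
    (ha : ∑ j, ‖a j‖ ≤ 1) (hb : ∑ j, ‖b j‖ ≤ 1) {θ : ℝ} (h0 : 0 ≤ θ) (h1 : θ ≤ 1 / 2) :
    ‖interpForm A a b θ‖ ≤ S ^ (1 - 2 * θ) * opNorm 2 A ^ (2 * θ) := by
  have h := HadamardThreeLines.norm_le_interp_of_mem_verticalClosedStrip' (z := θ)
    (by norm_num : (0 : ℝ) < 1 / 2) ⟨h0, h1⟩ (differentiable_interpForm A a b).diffContOnCl
    (bddAbove_norm_interpForm A ha hb le_rfl (by norm_num))
    (fun z hz => norm_interpForm_le_of_re_eq_zero hS hA ha hb hz)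
    (fun z hz => norm_interpForm_le_of_re_eq_half A ha hb hz)
  convert h using 3 <;> simp <;> ring

theorem norm_interpForm_le_of_half_le {S : ℝ} (hS : 0 ≤ S) (hA : ∀ j, ∑ i, ‖A i j‖ ≤ S)
    (ha : ∑ j, ‖a j‖ ≤ 1) (hb : ∑ j, ‖b j‖ ≤ 1) {θ : ℝ} (h0 : 1 / 2 ≤ θ) (h1 : θ ≤ 1) :
    ‖interpForm A a b θ‖ ≤ S ^ (2 * θ - 1) * opNorm 2 A ^ (2 - 2 * θ) := by
  have h := HadamardThreeLines.norm_le_interp_of_mem_verticalClosedStrip' (z := θ)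
    (by norm_num : (1 / 2 : ℝ) < 1) ⟨h0, h1⟩ (differentiable_interpForm A a b).diffContOnCl
    (bddAbove_norm_interpForm A ha hb (by norm_num) le_rfl)
    (fun z hz => norm_interpForm_le_of_re_eq_half A ha hb hz)
    (fun z hz => norm_interpForm_le_of_re_eq_one hS hA ha hb hz)
  rw [mul_comm]
  convert h using 3 <;> simp <;> ring

/-- Duality: the `ℓ^p` operator norm is controlled by the bilinear forms `interpForm A a b` at
`1 / p`, where `a` and `b` run over the unit ball of `ℓ^1`. -/
theorem opNorm_le_of_forall_norm_interpForm_le {p : ℝ≥0∞} (hp : 1 ≤ p) (hp' : p ≠ ∞) {K : ℝ}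
    (hK : 0 ≤ K) (h : ∀ a b : ι → ℂ, ∑ j, ‖a j‖ ≤ 1 → ∑ j, ‖b j‖ ≤ 1 →
      ‖interpForm A a b (p.toReal⁻¹ : ℝ)‖ ≤ K) : opNorm p A ≤ K := by
  have hq : 0 < p.toReal := ENNReal.toReal_pos (zero_lt_one.trans_le hp).ne' hp'
  refine opNorm_le_of_forall hK fun x hx => ?_
  rw [lpNorm, if_neg hp'] at hx ⊢
  set q := p.toReal
  set w := A *ᵥ x
  set W := ∑ i, ‖w i‖ ^ q
  have hW0 : 0 ≤ W := by positivity
  rcases hW0.eq_or_lt with hW | hW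
  · rw [← hW, Real.zero_rpow (inv_pos.2 hq).ne']
    exact hK
  have hpow (v : ℂ) : ‖phasePow v (q : ℂ)‖ = ‖v‖ ^ q := by
    rcases eq_or_ne v 0 with rfl | hv
    · simp [hq.ne']
    · simp [norm_phasePow hv]
  have hx1 : ∑ i, ‖x i‖ ^ q = 1 := by
    rwa [Real.rpow_inv_eq (by positivity) zero_le_one hq.ne', Real.one_rpow] at hx
  have hb1 (i : ι) : ‖phasePow (star (w i)) q / W‖ = ‖w i‖ ^ q / W := by
    rw [norm_div, hpow, norm_star, norm_real, Real.norm_of_nonneg hW0]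
  have key := h (fun j => phasePow (x j) q) (fun i => phasePow (star (w i)) q / W)
    (by simp [hpow, hx1]) (by simp only [hb1, ← Finset.sum_div]; exact (div_self hW.ne').le)
  have hx2 : (fun j => phasePow (phasePow (x j) q) ((q⁻¹ : ℝ) : ℂ)) = x := by
    ext j
    rw [phasePow_phasePow, ← ofReal_mul, mul_inv_cancel₀ hq.ne', ofReal_one, phasePow_one]
  rw [interpForm_eq_dotProduct, hx2] at key
  convert key
  have hterm (i : ι) : phasePow (phasePow (star (w i)) q / W) (1 - ((q⁻¹ : ℝ) : ℂ)) * w i =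
      ((‖w i‖ ^ q / W ^ (1 - q⁻¹) : ℝ) : ℂ) := by
    rcases eq_or_ne (w i) 0 with hw | hw
    · simp [hw, hq.ne']
    have hexp : (1 - ((q⁻¹ : ℝ) : ℂ)) = ((1 - q⁻¹ : ℝ) : ℂ) := by push_cast; rfl
    rw [hexp, phasePow_div_ofReal _ hW, phasePow_phasePow, ← ofReal_mul, div_mul_eq_mul_div,
      phasePow_star_mul_self hw, mul_sub, mul_inv_cancel₀ hq.ne', mul_one, sub_add_cancel,
      ofReal_div]
  have : (fun i => phasePow (phasePow (star (w i)) q / W) (1 - ((q⁻¹ : ℝ) : ℂ))) ⬝ᵥ w =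
      ((W ^ q⁻¹ : ℝ) : ℂ) := by
    simp only [dotProduct, hterm]
    rw [← ofReal_sum, ← Finset.sum_div, Real.rpow_sub hW, Real.rpow_one]
    congr 1
    change W / _ = _
    field_simp
  rw [this, norm_real, Real.norm_of_nonneg (by positivity)]

theorem opNorm_top_le {S : ℝ} (hS : 0 ≤ S) (hA : ∀ i, ∑ j, ‖A i j‖ ≤ S) : opNorm ⊤ A ≤ S := by
  refine opNorm_le_of_forall hS fun x hx => ?_
  rw [lpNorm, if_pos rfl] at hx ⊢
  refine Real.iSup_le (fun i => ?_) hS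
  have hxj (j : ι) : ‖x j‖ ≤ 1 :=
    (le_ciSup (Set.finite_range fun i => ‖x i‖).bddAbove j).trans hx.le
  calc ‖(A *ᵥ x) i‖ ≤ ∑ j, ‖A i j * x j‖ := norm_sum_le _ _
    _ ≤ ∑ j, ‖A i j‖ := by
        gcongr with j
        rw [norm_mul]
        exact mul_le_of_le_one_right (norm_nonneg _) (hxj j)
    _ ≤ S := hA i

theorem opNorm_le_of_le_two {S : ℝ} (hS : 0 ≤ S) (hA : ∀ j, ∑ i, ‖A i j‖ ≤ S) {p : ℝ≥0∞}
    (hp : 1 ≤ p) (hp2 : p ≤ 2) :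
    opNorm p A ≤ S ^ (2 * p.toReal⁻¹ - 1) * opNorm 2 A ^ (2 - 2 * p.toReal⁻¹) := by
  have hN := opNorm_nonneg 2 A
  have hp' : p ≠ ∞ := (hp2.trans_lt ENNReal.ofNat_lt_top).ne
  have h1 : 1 ≤ p.toReal := by simpa using ENNReal.toReal_mono hp' hp
  have h2 : p.toReal ≤ 2 := by simpa using ENNReal.toReal_mono ENNReal.ofNat_ne_top hp2
  refine opNorm_le_of_forall_norm_interpForm_le hp hp' (by positivity) fun a b ha hb =>
    norm_interpForm_le_of_half_le hS hA ha hb ?_ (inv_le_one_of_one_le₀ h1)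
  rw [one_div]
  gcongr

theorem opNorm_le_of_two_le {S : ℝ} (hS : 0 ≤ S) (hA : ∀ i, ∑ j, ‖A i j‖ ≤ S) {p : ℝ≥0∞}
    (hp : 2 ≤ p) :
    opNorm p A ≤ S ^ (1 - 2 * p.toReal⁻¹) * opNorm 2 A ^ (2 * p.toReal⁻¹) := by
  have hN := opNorm_nonneg 2 A
  rcases eq_or_ne p ∞ with rfl | hp'
  · simpa using opNorm_top_le hS hA
  have h2 : 2 ≤ p.toReal := by simpa using ENNReal.toReal_mono hp' hp
  refine opNorm_le_of_forall_norm_interpForm_le (one_le_two.trans hp) hp' (by positivity)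
    fun a b ha hb => norm_interpForm_le_of_le_half hS hA ha hb (by positivity) ?_
  rw [one_div]
  gcongr

end RieszThorin

theorem statement15 {n : ℕ} (hn : 0 < n) (α : Fin n → ℝ) :
    IsGreatest {r : ℝ | ∃ ω : ℂ, ω ^ n = 1 ∧ r = ‖∑ i, (α i : ℂ) * ω ^ (i : ℕ)‖}
      (opNorm 2 (circulantC fun i => (α i : ℂ))) ∧
    (∀ p : ℝ≥0∞, 1 ≤ p → p < 2 →
      opNorm 2 (circulantC fun i => (α i : ℂ)) ≤ opNorm p (circulantC fun i => (α i : ℂ)) ∧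
      opNorm p (circulantC fun i => (α i : ℂ)) ≤
        (∑ i, |α i|) ^ ((2 - p.toReal) / p.toReal) *
          opNorm 2 (circulantC fun i => (α i : ℂ)) ^ (2 * (p.toReal - 1) / p.toReal)) ∧
    (∀ p : ℝ≥0∞, 2 ≤ p →
      opNorm 2 (circulantC fun i => (α i : ℂ)) ≤ opNorm p (circulantC fun i => (α i : ℂ)) ∧
      opNorm p (circulantC fun i => (α i : ℂ)) ≤
        (∑ i, |α i|) ^ (1 - 2 * p.toReal⁻¹) *
          opNorm 2 (circulantC fun i => (α i : ℂ)) ^ (2 * p.toReal⁻¹)) := by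
  have : NeZero n := ⟨hn.ne'⟩
  have hS : 0 ≤ ∑ i, |α i| := Finset.sum_nonneg fun i _ => abs_nonneg _
  have hrow (i : Fin n) : ∑ j, ‖circulantC (fun i => (α i : ℂ)) i j‖ ≤ ∑ i, |α i| := by
    simp [sum_norm_circulantC_row]
  have hcol (j : Fin n) : ∑ i, ‖circulantC (fun i => (α i : ℂ)) i j‖ ≤ ∑ i, |α i| := by
    simp [sum_norm_circulantC_col]
  refine ⟨isGreatest_opNorm_two_circulantC _, fun p hp hp2 => ?_, fun p hp => ?_⟩
  · have : Fact (1 ≤ p) := ⟨hp⟩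
    refine ⟨opNorm_two_le_opNorm_circulantC p _, ?_⟩
    have hp0 : p.toReal ≠ 0 :=
      (ENNReal.toReal_pos (zero_lt_one.trans_le hp).ne' hp2.ne_top).ne'
    convert opNorm_le_of_le_two hS hcol hp hp2.le using 3 <;> field_simp
  · have : Fact (1 ≤ p) := ⟨one_le_two.trans hp⟩
    exact ⟨opNorm_two_le_opNorm_circulantC p _, opNorm_le_of_two_le hS hrow hp⟩
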